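/- Let S be a measurable space, let κ be a Markov kernel on S satisfying ‖κ(s) − κ(s′)‖_TV ≤ 2α for all s, s′ ∈ S with α ∈ (0,1), with unique invariant probability measure μ∞, and let r̄ : S → ℝ be a bounded measurable function. Then for every initial state s ∈ S, the long-run average reward exists as a limit and equals the stationary average: lim_{T→∞} (1/T) Σ_{t=0}^{T−1} ∫ r̄(x) dμ_t^s(x) = ∫ r̄(x) dμ∞(x), where μ_t^s denotes the t-step distribution of κ started from the Dirac measure at s. -/

import Mathlib

open MeasureTheory Filter

/-- Total variation distance: `‖μ − ν‖_TV = 2 · sup {|μ(B) − ν(B)| : B measurable}`. -/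
noncomputable def tvDist {S : Type*} [MeasurableSpace S] (μ ν : Measure S) : ℝ :=
  2 * ⨆ B : {B : Set S // MeasurableSet B}, |(μ B.1).toReal - (ν B.1).toReal|

/-- `stepIter κ t μ` is the `t`-step distribution, the `t`-fold iterate of
`μ ↦ bind μ κ` applied to `μ`. -/
noncomputable def stepIter {S : Type*} [MeasurableSpace S]
    (κ : S → Measure S) (t : ℕ) (μ : Measure S) : Measure S :=
  (fun m => m.bind κ)^[t] μ

open ProbabilityTheory in
/-- Integrals against a mixture `μ.bind κ` are iterated integrals. -/
lemma integral_bind_eq_integral_integral {S : Type*} [MeasurableSpace S]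
    {κ : S → Measure S} (hκm : Measurable κ) {μ : Measure S} {f : S → ℝ}
    (hf : Integrable f (μ.bind κ)) :
    ∫ x, f x ∂(μ.bind κ) = ∫ s, ∫ x, f x ∂(κ s) ∂μ :=
  Kernel.integral_comp (κ := Kernel.const Unit μ) (η := (⟨κ, hκm⟩ : Kernel S S)) (a := ()) hf

/-- The total variation distance bounds the discrepancy of two probability measures
on every measurable set. -/
lemma abs_measureReal_sub_le_of_tvDist_le {S : Type*} [MeasurableSpace S]
    {μ ν : Measure S} [IsProbabilityMeasure μ] [IsProbabilityMeasure ν] {α : ℝ}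
    (h : tvDist μ ν ≤ 2 * α) {B : Set S} (hB : MeasurableSet B) :
    |μ.real B - ν.real B| ≤ α := by
  have hbdd : BddAbove (Set.range fun B : {B : Set S // MeasurableSet B} =>
      |(μ B.1).toReal - (ν B.1).toReal|) := by
    refine ⟨1, ?_⟩
    rintro _ ⟨B, rfl⟩
    exact abs_sub_le_of_nonneg_of_le measureReal_nonneg measureReal_le_one
      measureReal_nonneg measureReal_le_one
  have hle := le_ciSup hbdd ⟨B, hB⟩
  unfold tvDist at h
  change |(μ B).toReal - (ν B).toReal| ≤ α
  linarith

/-- A function with bounded oscillation takes values in an interval of that length. -/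
lemma exists_mem_Icc_of_abs_sub_le {S : Type*} [Nonempty S] {f : S → ℝ} {D : ℝ}
    (h : ∀ x y, |f x - f y| ≤ D) : ∃ a, ∀ x, f x ∈ Set.Icc a (a + D) := by
  have hbdd : BddBelow (Set.range f) := by
    obtain ⟨x⟩ := ‹Nonempty S›
    refine ⟨f x - D, ?_⟩
    rintro _ ⟨y, rfl⟩
    linarith [(abs_le.1 (h x y)).2]
  refine ⟨⨅ x, f x, fun x => ⟨ciInf_le hbdd x, ?_⟩⟩
  have : f x - D ≤ ⨅ y, f y := le_ciInf fun y => by linarith [(abs_le.1 (h x y)).2]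
  linarith

/-- A measurable function with values in a bounded interval is integrable. -/
lemma integrable_of_forall_mem_Icc {S : Type*} [MeasurableSpace S] {μ : Measure S}
    [IsFiniteMeasure μ] {f : S → ℝ} (hf : Measurable f) {a b : ℝ}
    (h : ∀ x, f x ∈ Set.Icc a b) : Integrable f μ :=
  Integrable.of_mem_Icc a b hf.aemeasurable (ae_of_all _ h)

/-- If two probability measures differ by at most `α` on every measurable set, the integrals of
a function of oscillation at most `D` differ by at most `α * D`. -/
lemma abs_integral_sub_le_of_forall_measurableSet {S : Type*} [MeasurableSpace S]
    {μ ν : Measure S} [IsProbabilityMeasure μ] [IsProbabilityMeasure ν] {α : ℝ}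
    (h : ∀ B, MeasurableSet B → |μ.real B - ν.real B| ≤ α)
    {f : S → ℝ} (hf : Measurable f) {D : ℝ} (hD : ∀ x y, |f x - f y| ≤ D) :
    |∫ x, f x ∂μ - ∫ x, f x ∂ν| ≤ α * D := by
  have : Nonempty S := nonempty_of_isProbabilityMeasure μ
  obtain ⟨a, ha⟩ := exists_mem_Icc_of_abs_sub_le hD
  have hD0 : 0 ≤ D := (abs_nonneg _).trans (hD (Classical.arbitrary S) (Classical.arbitrary S))
  have layer : ∀ (ρ : Measure S) [IsProbabilityMeasure ρ],
      ∫ x, f x ∂ρ = a + ∫ t in Set.Ioc 0 D, ρ.real {x | t ≤ f x - a} := by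
    intro ρ _
    have hi : Integrable f ρ := integrable_of_forall_mem_Icc hf ha
    have hg : Integrable (fun x => f x - a) ρ := hi.sub (integrable_const a)
    rw [← hg.integral_eq_integral_Ioc_meas_le
      (ae_of_all _ fun x => sub_nonneg.2 (ha x).1)
      (ae_of_all _ fun x => sub_le_iff_le_add'.2 (ha x).2)]
    simp [integral_sub hi (integrable_const a)]
  have hint : ∀ (ρ : Measure S) [IsProbabilityMeasure ρ],
      IntegrableOn (fun t => ρ.real {x | t ≤ f x - a}) (Set.Ioc 0 D) := by
    intro ρ _
    have hanti : Antitone fun t => ρ.real {x | t ≤ f x - a} := fun s t hst =>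
      measureReal_mono fun x hx => le_trans hst hx
    exact Integrable.of_mem_Icc 0 1 hanti.measurable.aemeasurable
      (ae_of_all _ fun t => ⟨measureReal_nonneg, measureReal_le_one⟩)
  rw [layer μ, layer ν, add_sub_add_left_eq_sub, ← integral_sub (hint μ) (hint ν)]
  have := norm_setIntegral_le_of_norm_le_const (μ := volume) (s := Set.Ioc 0 D)
    (f := fun t => μ.real {x | t ≤ f x - a} - ν.real {x | t ≤ f x - a}) (C := α)
    (by simp) (fun t _ => h _ (measurableSet_le measurable_const (hf.sub_const a)))
  simpa [hD0] using this

section Iterates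

variable {S : Type*} [MeasurableSpace S] {κ : S → Measure S}

lemma stepIter_succ (t : ℕ) (μ : Measure S) :
    stepIter κ (t + 1) μ = (stepIter κ t μ).bind κ :=
  Function.iterate_succ_apply' _ _ _

lemma stepIter_of_bind_eq {μ : Measure S} (h : μ.bind κ = μ) (t : ℕ) :
    stepIter κ t μ = μ :=
  Function.iterate_fixed h t

lemma isProbabilityMeasure_stepIter (hκm : Measurable κ) (hκp : ∀ s, IsProbabilityMeasure (κ s))
    (t : ℕ) (μ : Measure S) [IsProbabilityMeasure μ] :
    IsProbabilityMeasure (stepIter κ t μ) := by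
  induction t with
  | zero => assumption
  | succ t ih =>
    rw [stepIter_succ]
    exact isProbabilityMeasure_bind hκm.aemeasurable (ae_of_all _ hκp)

open ProbabilityTheory in
/-- Under the Doeblin condition, expectations under any two initial distributions
merge geometrically fast. -/
lemma abs_integral_stepIter_sub_le (hκm : Measurable κ) (hκp : ∀ s, IsProbabilityMeasure (κ s))
    {α : ℝ} (hα : ∀ s s', tvDist (κ s) (κ s') ≤ 2 * α)
    (μ ν : Measure S) [IsProbabilityMeasure μ] [IsProbabilityMeasure ν] (t : ℕ)
    {f : S → ℝ} (hf : Measurable f) {D : ℝ} (hD : ∀ x y, |f x - f y| ≤ D) :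
    |∫ x, f x ∂(stepIter κ t μ) - ∫ x, f x ∂(stepIter κ t ν)| ≤ α ^ t * D := by
  have : Nonempty S := nonempty_of_isProbabilityMeasure μ
  induction t generalizing f D with
  | zero =>
    simpa [stepIter] using abs_integral_sub_le_of_forall_measurableSet (μ := μ) (ν := ν) (α := 1)
      (fun B _ => abs_sub_le_of_nonneg_of_le measureReal_nonneg measureReal_le_one
        measureReal_nonneg measureReal_le_one) hf hD
  | succ t ih =>
    obtain ⟨a, ha⟩ := exists_mem_Icc_of_abs_sub_le hD
    have step : ∀ (ρ : Measure S) [IsProbabilityMeasure ρ],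
        ∫ x, f x ∂(stepIter κ (t + 1) ρ) = ∫ s, ∫ x, f x ∂(κ s) ∂(stepIter κ t ρ) := by
      intro ρ _
      have := isProbabilityMeasure_stepIter hκm hκp (t + 1) ρ
      have hi : Integrable f (stepIter κ (t + 1) ρ) := integrable_of_forall_mem_Icc hf ha
      rw [stepIter_succ] at hi ⊢
      exact integral_bind_eq_integral_integral hκm hi
    have hm : Measurable fun s => ∫ x, f x ∂(κ s) :=
      (hf.stronglyMeasurable.integral_kernel (κ := (⟨κ, hκm⟩ : Kernel S S))).measurable
    have hosc : ∀ s s', |∫ x, f x ∂(κ s) - ∫ x, f x ∂(κ s')| ≤ α * D := fun s s' =>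
      abs_integral_sub_le_of_forall_measurableSet
        (fun B hB => abs_measureReal_sub_le_of_tvDist_le (hα s s') hB) hf hD
    rw [step μ, step ν, pow_succ, mul_assoc]
    exact ih hm hosc

end Iterates

/-- For a Doeblin Markov kernel with invariant probability measure `μ∞`
and a bounded measurable reward `r̄`, the long-run average reward from any initial state
exists as a limit and equals the stationary average `∫ r̄ dμ∞`. -/
theorem cesaro_average_reward {S : Type*} [MeasurableSpace S]
    (κ : S → Measure S) (hκm : Measurable κ)
    (hκp : ∀ s, IsProbabilityMeasure (κ s))
    (α : ℝ) (hα : α ∈ Set.Ioo (0 : ℝ) 1)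
    (hDoeblin : ∀ s s' : S, tvDist (κ s) (κ s') ≤ 2 * α)
    (μinf : Measure S) [IsProbabilityMeasure μinf] (hinv : μinf.bind κ = μinf)
    (rbar : S → ℝ) (hrm : Measurable rbar) (Cr : ℝ) (hrb : ∀ s, |rbar s| ≤ Cr)
    (s : S) :
    Tendsto
      (fun T : ℕ =>
        (1 / (T : ℝ)) * ∑ t ∈ Finset.range T, ∫ x, rbar x ∂(stepIter κ t (Measure.dirac s)))
      atTop (nhds (∫ x, rbar x ∂μinf)) := by
  have hosc : ∀ x y, |rbar x - rbar y| ≤ Cr + Cr := fun x y =>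
    (abs_sub _ _).trans (add_le_add (hrb x) (hrb y))
  have hlim : Tendsto (fun t => ∫ x, rbar x ∂(stepIter κ t (Measure.dirac s))) atTop
      (nhds (∫ x, rbar x ∂μinf)) := by
    have hgeom : Tendsto (fun t : ℕ => α ^ t * (Cr + Cr)) atTop (nhds 0) := by
      simpa using (tendsto_pow_atTop_nhds_zero_of_lt_one hα.1.le hα.2).mul_const (Cr + Cr)
    refine tendsto_iff_dist_tendsto_zero.2 (squeeze_zero (fun _ => dist_nonneg) (fun t => ?_) hgeom)
    have h := abs_integral_stepIter_sub_le hκm hκp hDoeblin (Measure.dirac s) μinf t hrm hosc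
    rwa [stepIter_of_bind_eq hinv] at h
  simpa only [one_div] using hlim.cesaro
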